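/- There exists a nonprincipal ultrafilter u on ℕ such that for every ordinal α < ω₁, u is not an α-ultrafilter; that is, for each α < ω₁ there is a function F : ℕ → ω₁ such that tp (F '' A) > α for every A ∈ u. -/

import Mathlib

open Set Topology Filter MeasureTheory

/-- The Cantor space `2^ω = ℕ → Bool` with the product topology. -/
abbrev Cantor := ℕ → Bool

/-- `u` is an `I`-ultrafilter: for every `F : ℕ → X` there is `A ∈ u` with `F '' A ∈ I`. -/
def IUltra {X : Type*} (I : Set (Set X)) (u : Ultrafilter ℕ) : Prop :=
  ∀ F : ℕ → X, ∃ A ∈ u, F '' A ∈ I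

/-- The same notion for ultrafilters on `ℕ × ℕ`. -/
def IUltra2 {X : Type*} (I : Set (Set X)) (u : Ultrafilter (ℕ × ℕ)) : Prop :=
  ∀ F : ℕ × ℕ → X, ∃ A ∈ u, F '' A ∈ I

/-- `u` is a P-point: nonprincipal, and every countable family of members of `u`
has a pseudo-intersection in `u`. -/
def IsPPoint (u : Ultrafilter ℕ) : Prop :=
  (∀ a : ℕ, u ≠ pure a) ∧
    ∀ A : ℕ → Set ℕ, (∀ n, A n ∈ u) → ∃ B ∈ u, ∀ n, (B \ A n).Finite

/-- A subset of Cantor space is discrete: every point of `A` is isolated in `A`. -/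
def DiscreteSet (A : Set Cantor) : Prop :=
  ∀ x ∈ A, ∃ U : Set Cantor, IsOpen U ∧ A ∩ U = {x}

/-- A subset of Cantor space is scattered: every nonempty subset has an isolated point. -/
def ScatteredSet (A : Set Cantor) : Prop :=
  ∀ B ⊆ A, B.Nonempty → ∃ x ∈ B, ∃ U : Set Cantor, IsOpen U ∧ B ∩ U = {x}

/-- The basic clopen cylinder `[s]` determined by a finite binary sequence `s`. -/
def cyl (s : List Bool) : Set Cantor := {f | ∀ i : Fin s.length, f i = s.get i}

/-- `I` is an ideal: closed under subsets and finite unions. -/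
def IsIdeal (I : Set (Set Cantor)) : Prop :=
  (∀ A B : Set Cantor, A ⊆ B → B ∈ I → A ∈ I) ∧
    (∀ A B : Set Cantor, A ∈ I → B ∈ I → A ∪ B ∈ I)

/-- `I` is closed under discrete unions. -/
def ClosedUnderDiscreteUnions (I : Set (Set Cantor)) : Prop :=
  ∀ (X G : ℕ → Set Cantor), (∀ n, X n ∈ I) → (∀ n, IsOpen (G n)) →
    Pairwise (Function.onFun Disjoint G) → (⋃ n, X n ∩ G n) ∈ I

/-- A discrete ideal: an ideal closed under discrete unions. -/
def DiscreteIdeal (I : Set (Set Cantor)) : Prop := IsIdeal I ∧ ClosedUnderDiscreteUnions I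

/-- `I` is closed under scattered unions. -/
def ClosedUnderScatteredUnions (I : Set (Set Cantor)) : Prop :=
  ∀ (S : Set (List Bool)) (X : List Bool → Set Cantor),
    S.WellFoundedOn (fun s t => cyl s ⊂ cyl t) → (∀ s ∈ S, X s ∈ I) →
    (⋃ s ∈ S, X s ∩ cyl s) ∈ I

/-- The sum `∑_u v_n`: the ultrafilter on `ℕ × ℕ` with
`X ∈ ∑_u v_n ↔ {n | {m | (n, m) ∈ X} ∈ v n} ∈ u`. -/
def ultraSum (u : Ultrafilter ℕ) (v : ℕ → Ultrafilter ℕ) : Ultrafilter (ℕ × ℕ) :=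
  u.bind fun n => (v n).map fun m => (n, m)

/-- Iterated derivative: `dA = {x ∈ A : x is an accumulation point of A}`;
`A` has level `≤ k` iff `d^k A = ∅`. -/
def HasLevelLE (k : ℕ) (A : Set Cantor) : Prop :=
  (fun B : Set Cantor => {x ∈ B | AccPt x (𝓟 B)})^[k] A = ∅

/-- Finite Fubini powers of `u` (relative to a pairing bijection `e`). -/
noncomputable def ultraPow (e : ℕ × ℕ ≃ ℕ) (u : Ultrafilter ℕ) : ℕ → Ultrafilter ℕ
  | 0 => pure 0
  | n + 1 => Ultrafilter.map e (ultraSum u fun _ => ultraPow e u n)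

/-- `u^ω = ∑_u ⟨u^n : n < ω⟩`, an ultrafilter on `ℕ × ℕ`. -/
noncomputable def ultraPowOmega (e : ℕ × ℕ ≃ ℕ) (u : Ultrafilter ℕ) : Ultrafilter (ℕ × ℕ) :=
  ultraSum u (ultraPow e u)

/-- The order type of a set of ordinals. -/
noncomputable def tp (X : Set Ordinal) : Ordinal := Ordinal.type ((· < ·) : X → X → Prop)

/-- The first uncountable ordinal. -/
noncomputable def omega1 : Ordinal := (Cardinal.aleph 1).ord

/-- `u` is an `α`-ultrafilter (`I_α`-ultrafilter, where `I_α` is the family of subsets of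
`ω₁` of order type `≤ α`). -/
def AlphaUltra (α : Ordinal) (u : Ultrafilter ℕ) : Prop :=
  ∀ F : ℕ → Ordinal, (∀ n, F n < omega1) → ∃ A ∈ u, tp (F '' A) ≤ α

/-- `u` is a `J_α`-ultrafilter (`J_α` is the family of subsets of `ω₁` of order type `< α`). -/
def JUltra (α : Ordinal) (u : Ultrafilter ℕ) : Prop :=
  ∀ F : ℕ → Ordinal, (∀ n, F n < omega1) → ∃ A ∈ u, tp (F '' A) < α

/-- The `J_α`-ultrafilter notion for ultrafilters on `ℕ × ℕ`. -/
def JUltra2 (α : Ordinal) (u : Ultrafilter (ℕ × ℕ)) : Prop :=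
  ∀ F : ℕ × ℕ → Ordinal, (∀ p, F p < omega1) → ∃ A ∈ u, tp (F '' A) < α

/-- A finite set of points of Cantor space is separated by some finite initial segment. -/
theorem exists_injOn_restrict_fin (s : Finset Cantor) :
    ∃ n : ℕ, InjOn (fun (r : Cantor) (i : Fin n) => r i) s := by
  have key : ∀ p : Cantor × Cantor, ∃ i : ℕ, p.1 ≠ p.2 → p.1 i ≠ p.2 i := by
    intro p
    by_cases h : p.1 = p.2
    · exact ⟨0, fun h' => absurd h h'⟩
    · obtain ⟨i, hi⟩ := Function.ne_iff.1 h
      exact ⟨i, fun _ => hi⟩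
  choose d hd using key
  refine ⟨(s ×ˢ s).sup fun p => d p + 1, fun r hr r' hr' h => ?_⟩
  by_contra hne
  have hmem : (r, r') ∈ s ×ˢ s := Finset.mem_product.2 ⟨hr, hr'⟩
  have hlt : d (r, r') < (s ×ˢ s).sup fun p => d p + 1 :=
    Nat.lt_of_succ_le (Finset.le_sup (f := fun p => d p + 1) hmem)
  exact hd (r, r') hne (congrFun h ⟨_, hlt⟩)

/-- There is an independent family of functions `ℕ → ℕ` indexed by the Cantor space. -/
theorem exists_independent_functions :
    ∃ f : Cantor → ℕ → ℕ, ∀ (s : Finset Cantor) (v : Cantor → ℕ),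
      ∃ m, ∀ r ∈ s, f r m = v r := by
  obtain ⟨e, he⟩ := exists_surjective_nat (Σ n : ℕ, ((Fin n → Bool) → ℕ))
  let ev : Cantor → (Σ n : ℕ, ((Fin n → Bool) → ℕ)) → ℕ := fun r p => p.2 fun i => r i
  refine ⟨fun r m => ev r (e m), fun s v => ?_⟩
  obtain ⟨n, hn⟩ := exists_injOn_restrict_fin s
  obtain ⟨m, hm⟩ :=
    he ⟨n, fun t => v (Function.invFunOn (fun (r : Cantor) (i : Fin n) => r i) s t)⟩
  refine ⟨m, fun r hr => ?_⟩
  change ev r (e m) = v r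
  rw [hm]
  exact congrArg v (hn.leftInvOn_invFunOn hr)

/-- The set `C` of ordinals contains a copy of the ordinal `β`. -/
def ContainsCopy (β : Ordinal) (C : Set Ordinal) : Prop :=
  ∃ g : Ordinal → Ordinal, StrictMonoOn g (Iio β) ∧ MapsTo g (Iio β) C

/-- If a copy of `β ^ k` is covered by `k` sets, one of them contains a copy of `β`. -/
theorem exists_containsCopy_of_cover {ι : Type*} (β : Ordinal) (C : ι → Set Ordinal)
    (s : Finset ι) (g : Ordinal → Ordinal) (hg : StrictMonoOn g (Iio (β ^ s.card)))
    (hC : ∀ x < β ^ s.card, ∃ i ∈ s, g x ∈ C i) : ∃ i ∈ s, ContainsCopy β (C i) := by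
  classical
  induction s using Finset.induction_on generalizing g with
  | empty =>
    obtain ⟨i, hi, -⟩ := hC 0 (by simp)
    simp at hi
  | insert a s ha ih =>
    rw [Finset.card_insert_of_notMem ha, pow_succ] at hg hC
    have hlt : ∀ b < β, ∀ x < β ^ s.card, β ^ s.card * b + x < β ^ s.card * β := by
      intro b hb x hx
      calc β ^ s.card * b + x < β ^ s.card * b + β ^ s.card := by gcongr
        _ = β ^ s.card * (b + 1) := by rw [mul_add, mul_one]
        _ ≤ β ^ s.card * β := by gcongr; exact Order.add_one_le_of_lt hb
    by_cases h : ∃ b < β, ∀ x < β ^ s.card, g (β ^ s.card * b + x) ∉ C a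
    · obtain ⟨b, hb, hba⟩ := h
      obtain ⟨i, hi, hCi⟩ := ih (fun x => g (β ^ s.card * b + x))
        (fun x hx y hy hxy => hg (hlt b hb x hx) (hlt b hb y hy) (by gcongr))
        (fun x hx => by
          obtain ⟨i, hi, hgi⟩ := hC _ (hlt b hb x hx)
          rcases Finset.mem_insert.1 hi with rfl | hi
          · exact absurd hgi (hba x hx)
          · exact ⟨i, hi, hgi⟩)
      exact ⟨i, Finset.mem_insert_of_mem hi, hCi⟩
    · push Not at h
      choose! x hx hxa using h
      refine ⟨a, Finset.mem_insert_self a s, fun b => g (β ^ s.card * b + x b), ?_, hxa⟩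
      intro b hb c hc hbc
      refine hg (hlt b hb _ (hx b hb)) (hlt c hc _ (hx c hc)) ?_
      calc β ^ s.card * b + x b < β ^ s.card * c := by
            calc β ^ s.card * b + x b < β ^ s.card * b + β ^ s.card := by
                  gcongr; exact hx b hb
              _ = β ^ s.card * (b + 1) := by rw [mul_add, mul_one]
              _ ≤ β ^ s.card * c := by gcongr; exact Order.add_one_le_of_lt hbc
        _ ≤ β ^ s.card * c + x c := le_self_add

theorem ContainsCopy.lift_le_tp.{u} {β : Ordinal.{u}} {C : Set Ordinal.{u}} (h : ContainsCopy β C) :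
    Ordinal.lift.{u + 1} β ≤ tp C := by
  obtain ⟨g, hg, hmaps⟩ := h
  rw [← Ordinal.type_lt_Iio, tp]
  exact Ordinal.type_le_iff'.2
    ⟨(OrderEmbedding.ofStrictMono (fun x : Iio β => (⟨g x, hmaps x.2⟩ : C))
      fun x y hxy => hg x.2 y.2 hxy).ltEmbedding⟩

theorem omega1_eq : omega1 = Ordinal.omega 1 := Cardinal.ord_aleph 1

theorem exists_lift_eq_of_lt_omega1.{v} (α : Ordinal.{v + 1}) (hα : α < omega1) :
    ∃ β : Ordinal.{v}, β < omega1 ∧ Ordinal.lift.{v + 1} β = α := by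
  have hlift : omega1.{v + 1} = Ordinal.lift.{v + 1} omega1.{v} := by
    rw [omega1_eq, omega1_eq, Ordinal.lift_omega, Ordinal.lift_one]
  rw [hlift] at hα
  exact Ordinal.lt_lift_iff.1 hα

/-- For `α < ω₁` there is a map `ℕ → ω₁` whose range is not a finite union of sets of
order type at most `α`. -/
theorem exists_range_not_finite_union.{u} (α : Ordinal.{u}) (hα : α < omega1) :
    ∃ e : ℕ → Ordinal.{u}, (∀ n, e n < omega1) ∧
      ∀ (s : Finset (Set ℕ)) (C : Set ℕ → Set Ordinal.{u}),
        (∀ i ∈ s, tp (C i) ≤ Ordinal.lift.{u + 1} α) → ∃ n, ∀ i ∈ s, e n ∉ C i := by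
  rw [omega1_eq] at *
  have hlim : Order.IsSuccLimit (Ordinal.omega.{u} 1) := Cardinal.isSuccLimit_omega 1
  have hγ : (α + 1) ^ Ordinal.omega0.{u} < Ordinal.omega.{u} 1 :=
    Ordinal.isPrincipal_opow_omega 1 (hlim.add_one_lt hα) Ordinal.omega0_lt_omega_one
  set γ := (α + 1) ^ Ordinal.omega0.{u} with hγdef
  have hcount : (Iio γ).Countable := by
    rw [← Cardinal.le_aleph0_iff_set_countable, Cardinal.mk_Iio_ordinal,
      Cardinal.lift_le_aleph0]
    rwa [← Cardinal.ord_aleph, Cardinal.lt_ord, ← Cardinal.succ_aleph0, Order.lt_succ_iff] at hγ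
  have hpos : (Iio γ).Nonempty := ⟨0, Ordinal.opow_pos _ (by simp)⟩
  obtain ⟨e, he⟩ := hcount.exists_eq_range hpos
  refine ⟨e, fun n => ?_, fun s C hs => ?_⟩
  · have : e n ∈ Iio γ := he ▸ mem_range_self n
    exact lt_trans this hγ
  · by_contra! hcov
    obtain ⟨i, hi, hCi⟩ := exists_containsCopy_of_cover (α + 1) C s id
      (strictMono_id.strictMonoOn _) (fun x hx => by
        have hxγ : x ∈ Iio γ := hx.trans_le (by
          rw [hγdef, ← Ordinal.opow_natCast]
          exact Ordinal.opow_le_opow_right (by simp) (Ordinal.natCast_lt_omega0 _).le)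
        rw [he] at hxγ
        obtain ⟨n, rfl⟩ := hxγ
        exact hcov n)
    have := hCi.lift_le_tp.trans (hs i hi)
    exact absurd (Ordinal.lift_le.1 this) (by simp)

/-- The ordinals below `ω₁` embed into the Cantor space. -/
theorem exists_injOn_omega1_cantor.{u} :
    ∃ r : Ordinal.{u} → Cantor, InjOn r (Iio omega1) := by
  have h : Nonempty (Iio omega1.{u} ↪ Cantor) := by
    rw [← Cardinal.lift_mk_le', Cardinal.mk_Iio_ordinal, omega1, Cardinal.card_ord]
    simpa using Cardinal.aleph_one_le_continuum
  obtain ⟨j⟩ := h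
  classical
  refine ⟨fun a => if h : a < omega1 then j ⟨a, h⟩ else fun _ => false, fun a ha b hb hab => ?_⟩
  rw [mem_Iio] at ha hb
  simp only [dif_pos ha, dif_pos hb] at hab
  exact congrArg Subtype.val (j.injective hab)

/-- There is an ultrafilter on `ℕ` which, for each `α < ω₁`, admits a map `ℕ → ω₁` sending every
member of the ultrafilter to a set of order type greater than `α`. -/
theorem exists_ultrafilter_lift_lt_tp.{v} :
    ∃ u : Ultrafilter ℕ, ∀ α : Ordinal.{v}, α < omega1 → ∃ F : ℕ → Ordinal.{v},
      (∀ n, F n < omega1) ∧ ∀ A ∈ u, Ordinal.lift.{v + 1} α < tp (F '' A) := by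
  classical
  obtain ⟨f, hf⟩ := exists_independent_functions
  obtain ⟨r, hr⟩ := exists_injOn_omega1_cantor
  choose! e he hcov using exists_range_not_finite_union
  set F : Ordinal.{v} → ℕ → Ordinal.{v} := fun α m => e α (f (r α) m) with hF
  obtain ⟨u, hu⟩ := Ultrafilter.exists_ultrafilter_of_finite_inter_nonempty
    {A : Set ℕ | ∃ α : Ordinal.{v}, α < omega1 ∧ tp (F α '' Aᶜ) ≤ Ordinal.lift.{v + 1} α} (by
      intro T hT
      replace hT : ∀ A ∈ T, ∃ α : Ordinal.{v}, α < omega1 ∧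
          tp (F α '' Aᶜ) ≤ Ordinal.lift.{v + 1} α := fun A hA => hT hA
      choose! a ha htp using hT
      have hn : ∀ α < omega1, ∃ n, ∀ A ∈ T.filter (a · = α), e α n ∉ F α '' Aᶜ :=
        fun α hα => hcov α hα _ (fun A => F α '' Aᶜ) fun A hA => by
          obtain ⟨hAT, rfl⟩ := Finset.mem_filter.1 hA
          exact htp A hAT
      choose! v hv using hn
      obtain ⟨m, hm⟩ := hf (T.image fun A => r (a A))
        (fun x => v (Function.invFunOn r (Iio omega1) x))
      refine ⟨m, fun A hA => ?_⟩
      have hmA := hm _ (Finset.mem_image_of_mem _ hA)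
      rw [hr.leftInvOn_invFunOn (ha A hA)] at hmA
      by_contra hmem
      exact hv (a A) (ha A hA) A (Finset.mem_filter.2 ⟨hA, rfl⟩) ⟨m, hmem, by simp only [hF, hmA]⟩)
  refine ⟨u, fun α hα => ⟨F α, fun n => he α hα _, fun A hA => ?_⟩⟩
  by_contra! hle
  exact Ultrafilter.compl_notMem_iff.2 hA (hu ⟨α, hα, by rwa [compl_compl]⟩)

/-- ZFC: there is a nonprincipal ultrafilter on `ℕ` that is not an
`α`-ultrafilter for any `α < ω₁`. -/
theorem stmt19 :
    ∃ u : Ultrafilter ℕ, (∀ a : ℕ, u ≠ pure a) ∧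
      ∀ α < omega1, ∃ F : ℕ → Ordinal,
        (∀ n, F n < omega1) ∧ ∀ A ∈ u, α < tp (F '' A) := by
  obtain ⟨u, hu⟩ := exists_ultrafilter_lift_lt_tp
  refine ⟨u, ?_, fun α hα => ?_⟩
  · rintro a rfl
    have one_lt : 1 < omega1 := by
      rw [omega1_eq]
      exact Ordinal.one_lt_omega0.trans Ordinal.omega0_lt_omega_one
    obtain ⟨F, -, hF⟩ := hu 1 one_lt
    have h := hF {a} (by simp)
    rw [image_singleton, tp] at h
    simp at h
  · obtain ⟨β, hβ, rfl⟩ := exists_lift_eq_of_lt_omega1 α hα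
    exact hu β hβ
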